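/- arXiv:2310.00251 — 9 statements merged into one kernel-verified Lean document; each statement's English description precedes it below -/
import Mathlib

section
/- If n = dim V ≥ 3, then the direct sum graph Γ_{U⊕W}(V) is connected and its diameter equals 2. -/
/-- The direct sum graph `Γ_{U⊕W}(V)` of a vector space `V = U ⊕ W` over a field `F`,
with `dim U = r`, `dim W = s`, described in coordinates with respect to fixed bases
`{α_1,…,α_r}` of `U` and `{β_1,…,β_s}` of `W`: a vector `x` is identified with the pair
of its coefficient tuples `(a, b)`, the vertices are those `x` whose `U`-part and `W`-part
are both nonzero, and two distinct vertices are adjacent iff they share a basis vector of `U`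
with nonzero coefficient and a basis vector of `W` with nonzero coefficient. -/
def directSumGraph (F : Type*) [Field F] (r s : ℕ) :
    SimpleGraph {x : (Fin r → F) × (Fin s → F) // x.1 ≠ 0 ∧ x.2 ≠ 0} where
  Adj x y := x ≠ y ∧ (∃ i, x.val.1 i ≠ 0 ∧ y.val.1 i ≠ 0) ∧
    (∃ j, x.val.2 j ≠ 0 ∧ y.val.2 j ≠ 0)
  symm := by
    constructor
    rintro x y ⟨hxy, ⟨i, hi1, hi2⟩, ⟨j, hj1, hj2⟩⟩
    exact ⟨hxy.symm, ⟨i, hi2, hi1⟩, ⟨j, hj2, hj1⟩⟩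
  loopless := by constructor; rintro x ⟨hx, -⟩; exact hx rfl

/-- If `n = dim V ≥ 3`, the direct sum graph is connected and has diameter 2. -/
theorem directSumGraph_connected_and_diam_eq_two (F : Type*) [Field F] (r s : ℕ)
    (hr : 1 ≤ r) (hs : 1 ≤ s) (hn : 3 ≤ r + s) :
    (directSumGraph F r s).Connected ∧ (directSumGraph F r s).diam = 2 := by
  classical
  have hr0 : 0 < r := hr
  have hs0 : 0 < s := hs
  have one_ne : ∀ m : ℕ, 0 < m → (fun _ : Fin m => (1 : F)) ≠ 0 := by
    intro m hm h
    exact one_ne_zero (congrFun h ⟨0, hm⟩)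
  let z : {x : (Fin r → F) × (Fin s → F) // x.1 ≠ 0 ∧ x.2 ≠ 0} :=
    ⟨(fun _ => 1, fun _ => 1), one_ne r hr0, one_ne s hs0⟩
  haveI : Nonempty {x : (Fin r → F) × (Fin s → F) // x.1 ≠ 0 ∧ x.2 ≠ 0} := ⟨z⟩
  have hz : (directSumGraph F r s).eccent z ≤ 1 := by
    rw [SimpleGraph.eccent_le_one_iff]
    intro v hv
    obtain ⟨i, hi⟩ := Function.ne_iff.mp v.2.1
    obtain ⟨j, hj⟩ := Function.ne_iff.mp v.2.2
    exact ⟨hv, ⟨i, one_ne_zero, hi⟩, ⟨j, one_ne_zero, hj⟩⟩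
  have hle : (directSumGraph F r s).ediam ≤ 2 := by
    refine (SimpleGraph.ediam_le_two_mul_eccent z).trans ?_
    calc 2 * (directSumGraph F r s).eccent z ≤ 2 * 1 := by gcongr
      _ = 2 := by norm_num
  have htop : (directSumGraph F r s).ediam ≠ ⊤ := by
    intro h
    rw [h] at hle
    exact absurd hle (by decide)
  have hex : ∃ x y, x ≠ y ∧ ¬ (directSumGraph F r s).Adj x y := by
    have hsing : ∀ (m : ℕ) (i : Fin m), (Pi.single i 1 : Fin m → F) ≠ 0 := by
      intro m i h
      have := congrFun h i
      simp at this
    have hdis : ∀ (m : ℕ) (a b : Fin m), a ≠ b →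
        ¬ ∃ i, (Pi.single a 1 : Fin m → F) i ≠ 0 ∧ (Pi.single b 1 : Fin m → F) i ≠ 0 := by
      rintro m a b hab ⟨i, h1, h2⟩
      simp only [Pi.single_apply] at h1 h2
      grind
    rcases (by omega : 2 ≤ r ∨ 2 ≤ s) with h | h
    · have hab : (⟨0, by omega⟩ : Fin r) ≠ ⟨1, by omega⟩ := by simp
      refine ⟨⟨(Pi.single ⟨0, by omega⟩ 1, fun _ => 1), hsing _ _, one_ne s hs0⟩,
        ⟨(Pi.single ⟨1, by omega⟩ 1, fun _ => 1), hsing _ _, one_ne s hs0⟩, ?_, ?_⟩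
      · intro e
        have e1 := congrArg (fun x => x.val.1 ⟨0, by omega⟩) e
        simp [Pi.single_apply] at e1
      · rintro ⟨-, h1, -⟩
        exact hdis _ _ _ hab h1
    · have hab : (⟨0, by omega⟩ : Fin s) ≠ ⟨1, by omega⟩ := by simp
      refine ⟨⟨(fun _ => 1, Pi.single ⟨0, by omega⟩ 1), one_ne r hr0, hsing _ _⟩,
        ⟨(fun _ => 1, Pi.single ⟨1, by omega⟩ 1), one_ne r hr0, hsing _ _⟩, ?_, ?_⟩
      · intro e
        have e1 := congrArg (fun x => x.val.2 ⟨0, by omega⟩) e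
        simp [Pi.single_apply] at e1
      · rintro ⟨-, -, h1⟩
        exact hdis _ _ _ hab h1
  obtain ⟨x, y, hxy, hadj⟩ := hex
  haveI : Nontrivial {x : (Fin r → F) × (Fin s → F) // x.1 ≠ 0 ∧ x.2 ≠ 0} := ⟨x, y, hxy⟩
  refine ⟨SimpleGraph.connected_of_ediam_ne_top htop, ?_⟩
  have h0 := SimpleGraph.diam_ne_zero_of_ediam_ne_top htop
  have h1 : (directSumGraph F r s).diam ≠ 1 := by
    intro h
    rw [SimpleGraph.diam_eq_one] at h
    apply hadj
    rw [h]
    exact hxy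
  have h2 : (directSumGraph F r s).diam ≤ 2 := by
    exact ENat.toNat_le_of_le_coe hle
  omega
end

section
/- If D = {x_1, x_2, …, x_k} is a minimal dominating set of Γ_{U⊕W}(V) (that is, D is a dominating set and no proper subset of D is a dominating set), then k ≤ dim(U)·dim(W) = r·s. -/
/-- A set `D` of vertices is dominating if every vertex outside `D` is adjacent to some
vertex of `D`. -/
def IsDominatingSet {V : Type*} (G : SimpleGraph V) (D : Finset V) : Prop :=
  ∀ v ∉ D, ∃ u ∈ D, G.Adj u v

/-- A minimal dominating set of the direct sum graph has at most `dim U * dim W = r * s`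
elements. -/
theorem card_le_of_minimal_dominating (F : Type*) [Field F] (r s : ℕ)
    (hr : 1 ≤ r) (hs : 1 ≤ s)
    (D : Finset {x : (Fin r → F) × (Fin s → F) // x.1 ≠ 0 ∧ x.2 ≠ 0})
    (hdom : IsDominatingSet (directSumGraph F r s) D)
    (hmin : ∀ D' ⊂ D, ¬ IsDominatingSet (directSumGraph F r s) D') :
    D.card ≤ r * s := by
  classical
  have key : ∀ x ∈ D, ∃ p : Fin r × Fin s, (x.val.1 p.1 ≠ 0 ∧ x.val.2 p.2 ≠ 0) ∧
      ∀ u ∈ D, u.val.1 p.1 ≠ 0 → u.val.2 p.2 ≠ 0 → u = x := by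
    intro x hx
    have h := hmin (D.erase x) (Finset.erase_ssubset hx)
    unfold IsDominatingSet at h
    push Not at h
    obtain ⟨v, hv, hv2⟩ := h
    have hfin : ∀ i j, v.val.1 i ≠ 0 → v.val.2 j ≠ 0 →
        ∀ u ∈ D, u.val.1 i ≠ 0 → u.val.2 j ≠ 0 → u = x := by
      intro i j hi hj u hu hui huj
      by_contra hne
      have hmem : u ∈ D.erase x := Finset.mem_erase.2 ⟨hne, hu⟩
      refine hv2 u hmem ⟨?_, ⟨i, hui, hi⟩, ⟨j, huj, hj⟩⟩
      rintro rfl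
      exact hv hmem
    by_cases hvx : v = x
    · subst hvx
      obtain ⟨i, hi⟩ := Function.ne_iff.1 v.2.1
      obtain ⟨j, hj⟩ := Function.ne_iff.1 v.2.2
      exact ⟨(i, j), ⟨hi, hj⟩, hfin i j hi hj⟩
    · have hvD : v ∉ D := fun h => hv (Finset.mem_erase.2 ⟨hvx, h⟩)
      obtain ⟨u, hu, hadj⟩ := hdom v hvD
      obtain ⟨-, ⟨i, hui, hi⟩, ⟨j, huj, hj⟩⟩ := id hadj
      have hux := hfin i j hi hj u hu hui huj
      subst hux
      exact ⟨(i, j), ⟨hui, huj⟩, hfin i j hi hj⟩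
  choose f hf1 hf2 using key
  have hcard : D.attach.card ≤ (Finset.univ : Finset (Fin r × Fin s)).card := by
    refine Finset.card_le_card_of_injOn (fun x => f x.1 x.2) (fun _ _ => Finset.mem_univ _) ?_
    intro x _ y _ hxy
    have hxy' : f x.1 x.2 = f y.1 y.2 := hxy
    apply Subtype.ext
    have h1 := hf1 x.1 x.2
    rw [hxy'] at h1
    exact hf2 y.1 y.2 x.1 x.2 h1.1 h1.2
  simpa using hcard
end

section
/- If n = dim V ≥ 3, then the independence number of Γ_{U⊕W}(V) equals dim(U)·dim(W) = r·s; in particular the set {α_i + β_j : 1 ≤ i ≤ r, 1 ≤ j ≤ s} is an independent set of maximum size. -/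
/-- The independence number: the maximum cardinality of a set of pairwise non-adjacent
vertices. -/
noncomputable def indepNumber {V : Type*} (G : SimpleGraph V) : ℕ :=
  sSup {n | ∃ S : Finset V, (S : Set V).Pairwise (fun a b => ¬ G.Adj a b) ∧ S.card = n}

/-- If `n = dim V ≥ 3`, the independence number of the direct sum graph is
`dim U * dim W = r * s`; in particular, the set `{α_i + β_j}` is an independent set of
maximum size `r * s`. -/
theorem directSumGraph_indepNumber (F : Type*) [Field F] (r s : ℕ)
    (hr : 1 ≤ r) (hs : 1 ≤ s) (hn : 3 ≤ r + s) :
    indepNumber (directSumGraph F r s) = r * s ∧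
    ({x | ∃ (i : Fin r) (j : Fin s),
        x.val = (Pi.single i (1 : F), Pi.single j (1 : F))} :
          Set {x : (Fin r → F) × (Fin s → F) // x.1 ≠ 0 ∧ x.2 ≠ 0}).Pairwise
        (fun a b => ¬ (directSumGraph F r s).Adj a b) ∧
    ({x | ∃ (i : Fin r) (j : Fin s),
        x.val = (Pi.single i (1 : F), Pi.single j (1 : F))} :
          Set {x : (Fin r → F) × (Fin s → F) // x.1 ≠ 0 ∧ x.2 ≠ 0}).ncard = r * s := by
  classical
  set A : Set {x : (Fin r → F) × (Fin s → F) // x.1 ≠ 0 ∧ x.2 ≠ 0} :=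
    {x | ∃ (i : Fin r) (j : Fin s),
        x.val = (Pi.single i (1 : F), Pi.single j (1 : F))} with hA
  let f : Fin r × Fin s → {x : (Fin r → F) × (Fin s → F) // x.1 ≠ 0 ∧ x.2 ≠ 0} :=
    fun p => ⟨(Pi.single p.1 (1 : F), Pi.single p.2 (1 : F)), by simp, by simp⟩
  have hf : Function.Injective f := by
    rintro ⟨i, j⟩ ⟨i', j'⟩ h
    have h' := congrArg Subtype.val h
    simp only [f, Prod.mk.injEq] at h'
    have h1 := congrFun h'.1 i
    have h2 := congrFun h'.2 j
    simp only [Pi.single_apply, if_true] at h1 h2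
    have e1 : i = i' := by
      by_contra hne
      simp [hne] at h1
    have e2 : j = j' := by
      by_contra hne
      simp [hne] at h2
    rw [e1, e2]
  have hAf : A = ((Finset.univ.image f : Finset _) : Set _) := by
    ext x
    simp only [hA, Set.mem_setOf_eq, Finset.coe_image, Finset.coe_univ, Set.image_univ,
      Set.mem_range, Prod.exists, f, Subtype.ext_iff]
    exact ⟨fun ⟨i, j, h⟩ => ⟨i, j, h.symm⟩, fun ⟨i, j, h⟩ => ⟨i, j, h.symm⟩⟩
  have hcard : (Finset.univ.image f).card = r * s := by
    rw [Finset.card_image_of_injective _ hf]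
    simp
  have hpair : A.Pairwise (fun a b => ¬ (directSumGraph F r s).Adj a b) := by
    rintro x ⟨i, j, hx⟩ y ⟨i', j', hy⟩ hxy ⟨-, ⟨k, hk1, hk2⟩, ⟨l, hl1, hl2⟩⟩
    apply hxy
    rw [hx] at hk1 hl1
    rw [hy] at hk2 hl2
    simp only [Pi.single_apply, ne_eq, ite_eq_right_iff, one_ne_zero, imp_false, not_not]
      at hk1 hk2 hl1 hl2
    subst hk1 hk2 hl1 hl2
    exact Subtype.ext (hx.trans hy.symm)
  refine ⟨?_, hpair, ?_⟩
  · refine IsGreatest.csSup_eq ⟨⟨Finset.univ.image f, ?_, hcard⟩, ?_⟩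
    · rw [← hAf]
      exact hpair
    · rintro n ⟨S, hS, rfl⟩
      have hU : ∀ x : {x : (Fin r → F) × (Fin s → F) // x.1 ≠ 0 ∧ x.2 ≠ 0},
          ∃ i, x.val.1 i ≠ 0 := fun x => Function.ne_iff.mp x.2.1
      have hW : ∀ x : {x : (Fin r → F) × (Fin s → F) // x.1 ≠ 0 ∧ x.2 ≠ 0},
          ∃ j, x.val.2 j ≠ 0 := fun x => Function.ne_iff.mp x.2.2
      choose u hu using hU
      choose w hw using hW
      have hle : S.card ≤ (Finset.univ : Finset (Fin r × Fin s)).card := by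
        refine Finset.card_le_card_of_injOn (fun x => (u x, w x)) (fun _ _ => by simp) ?_
        intro x hx y hy hxy
        by_contra hne
        simp only [Prod.mk.injEq] at hxy
        exact hS hx hy hne ⟨hne, ⟨u x, hu x, hxy.1 ▸ hu y⟩, ⟨w x, hw x, hxy.2 ▸ hw y⟩⟩
      simpa using hle
  · rw [hAf, Set.ncard_coe_finset, hcard]
end

section
/- Let x be a vertex of Γ_{U⊕W}(V) with exactly l nonzero coefficients on the basis of U and exactly m nonzero coefficients on the basis of W (that is, |S_x^U| = l with 1 ≤ l ≤ r and |S_x^W| = m with 1 ≤ m ≤ s). Then the degree of x in Γ_{U⊕W}(V) equals (q^l − 1)(q^m − 1)q^{n−(l+m)} − 1. -/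
noncomputable instance {F : Type*} [Field F] {r s : ℕ} :
    DecidableRel (directSumGraph F r s).Adj := Classical.decRel _

theorem dsg_count {F : Type*} [Field F] [Fintype F] [DecidableEq F] {r : ℕ} (a : Fin r → F) (l : ℕ)
    (hl : (Finset.univ.filter fun i => a i ≠ 0).card = l) :
    (Finset.univ.filter fun y : Fin r → F => ∃ i, a i ≠ 0 ∧ y i ≠ 0).card
      = (Fintype.card F ^ l - 1) * Fintype.card F ^ (r - l) := by
  have h0 := Finset.card_filter_add_card_filter_not (s := (Finset.univ : Finset (Fin r)))
    (fun i => a i ≠ 0)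
  have h1 := Finset.card_filter_add_card_filter_not (s := (Finset.univ : Finset (Fin r → F)))
    (fun y : Fin r → F => ∃ i, a i ≠ 0 ∧ y i ≠ 0)
  have h2 : (Finset.univ.filter fun y : Fin r → F => ¬ ∃ i, a i ≠ 0 ∧ y i ≠ 0)
      = Fintype.piFinset (fun i => if a i ≠ 0 then ({0} : Finset F) else Finset.univ) := by
    ext y
    simp only [Finset.mem_filter, Finset.mem_univ, true_and, Fintype.mem_piFinset, not_exists]
    refine forall_congr' fun i => ?_
    by_cases h : a i = 0 <;> simp [h]
  have h3 : (Fintype.piFinset (fun i => if a i ≠ 0 then ({0} : Finset F) else Finset.univ)).card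
      = Fintype.card F ^ (r - l) := by
    rw [Fintype.card_piFinset]
    simp only [apply_ite Finset.card, Finset.card_singleton, Finset.card_univ]
    rw [Finset.prod_ite, Finset.prod_const_one, one_mul, Finset.prod_const]
    congr 1
    simp only [Finset.card_univ, Fintype.card_fin] at h0
    omega
  rw [h2, h3] at h1
  simp only [Finset.card_univ, Fintype.card_fin, Fintype.card_pi, Finset.prod_const] at h1 h0
  have hlr : l ≤ r := by omega
  rw [Nat.sub_mul, ← pow_add, one_mul, Nat.add_sub_cancel' hlr]
  omega

/-- Degree formula: a vertex with exactly `l` nonzero coefficients on the basis of `U` and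
`m` nonzero coefficients on the basis of `W` has degree `(q^l − 1)(q^m − 1)q^{n−(l+m)} − 1`. -/
theorem directSumGraph_degree (F : Type*) [Field F] [Fintype F] [DecidableEq F]
    (q r s l m : ℕ) (hq : Fintype.card F = q)
    (x : {x : (Fin r → F) × (Fin s → F) // x.1 ≠ 0 ∧ x.2 ≠ 0})
    (hl : (Finset.univ.filter fun i => x.val.1 i ≠ 0).card = l)
    (hm : (Finset.univ.filter fun j => x.val.2 j ≠ 0).card = m)
    (hl1 : 1 ≤ l) (hlr : l ≤ r) (hm1 : 1 ≤ m) (hms : m ≤ s) :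
    (directSumGraph F r s).degree x = (q ^ l - 1) * (q ^ m - 1) * q ^ (r + s - (l + m)) - 1 := by
  classical
  subst hq
  have key : ((directSumGraph F r s).neighborFinset x).map (Function.Embedding.subtype _)
      = ((Finset.univ.filter fun y : Fin r → F => ∃ i, x.val.1 i ≠ 0 ∧ y i ≠ 0) ×ˢ
        (Finset.univ.filter fun y : Fin s → F => ∃ i, x.val.2 i ≠ 0 ∧ y i ≠ 0)).erase x.val := by
    ext y
    simp only [Finset.mem_map, SimpleGraph.mem_neighborFinset, Finset.mem_erase,
      Finset.mem_product, Finset.mem_filter, Finset.mem_univ, true_and]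
    constructor
    · rintro ⟨z, ⟨h1, h2, h3⟩, rfl⟩
      exact ⟨fun h => h1 (Subtype.ext h.symm), h2, h3⟩
    · rintro ⟨h1, ⟨i, hi, hi'⟩, ⟨j, hj, hj'⟩⟩
      refine ⟨⟨y, fun h => hi' (by rw [h]; rfl), fun h => hj' (by rw [h]; rfl)⟩,
        ⟨fun h => h1 (by rw [h]), ⟨i, hi, hi'⟩, ⟨j, hj, hj'⟩⟩, rfl⟩
  have hx : x.val ∈ ((Finset.univ.filter fun y : Fin r → F => ∃ i, x.val.1 i ≠ 0 ∧ y i ≠ 0) ×ˢ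
        (Finset.univ.filter fun y : Fin s → F => ∃ i, x.val.2 i ≠ 0 ∧ y i ≠ 0)) := by
    obtain ⟨i, hi⟩ := Function.ne_iff.1 x.2.1
    obtain ⟨j, hj⟩ := Function.ne_iff.1 x.2.2
    simp only [Finset.mem_product, Finset.mem_filter, Finset.mem_univ, true_and]
    exact ⟨⟨i, hi, hi⟩, ⟨j, hj, hj⟩⟩
  have hc := congrArg Finset.card key
  rw [Finset.card_map, Finset.card_erase_of_mem hx, Finset.card_product, dsg_count _ l hl,
    dsg_count _ m hm] at hc
  have he : r + s - (l + m) = (r - l) + (s - m) := by omega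
  rw [← SimpleGraph.card_neighborFinset_eq_degree, he, pow_add]
  refine Eq.trans ?_ (hc.trans ?_)
  · congr!
  · congr 1
    ring
end

section
/- The number M of edges of Γ_{U⊕W}(V) satisfies 2M = (q^{2r} − (2q − 1)^r)(q^{2s} − (2q − 1)^s) − (q^r − 1)(q^s − 1). -/
abbrev DSGMeet (F : Type*) [Field F] (r : ℕ) :=
  {p : (Fin r → F) × (Fin r → F) // ∃ i, p.1 i ≠ 0 ∧ p.2 i ≠ 0}

lemma dsg_pair_card (F : Type*) [Field F] [Fintype F] [DecidableEq F] :
    (Nat.card {c : F × F // c.1 = 0 ∨ c.2 = 0} : ℤ) = 2 * (Fintype.card F : ℤ) - 1 := by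
  have h1 : Nat.card {c : F × F // c.1 = 0 ∨ c.2 = 0} + Nat.card {c : F × F // ¬ (c.1 = 0 ∨ c.2 = 0)}
      = Nat.card (F × F) := by
    rw [← Nat.card_sum]
    exact Nat.card_congr (Equiv.sumCompl _)
  have e : {c : F × F // ¬ (c.1 = 0 ∨ c.2 = 0)} ≃ {a : F // ¬ a = 0} × {a : F // ¬ a = 0} :=
    { toFun := fun c => (⟨c.1.1, fun h => c.2 (Or.inl h)⟩, ⟨c.1.2, fun h => c.2 (Or.inr h)⟩)
      invFun := fun c => ⟨(c.1.1, c.2.1), fun h => h.elim c.1.2 c.2.2⟩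
      left_inv := fun _ => rfl
      right_inv := fun _ => rfl }
  have h2 : 1 + Nat.card {a : F // ¬ a = 0} = Nat.card F := by
    rw [← Nat.card_congr (Equiv.sumCompl (fun a : F => a = 0)), Nat.card_sum]
    simp
  rw [Nat.card_congr e, Nat.card_prod, Nat.card_prod, ← h2] at h1
  rw [← Nat.card_eq_fintype_card, ← h2]
  zify at h1
  push_cast
  linarith

lemma dsg_meet_card (F : Type*) [Field F] [Fintype F] [DecidableEq F] (r : ℕ) :
    (Nat.card (DSGMeet F r) : ℤ) =
      (Fintype.card F : ℤ) ^ (2 * r) - (2 * (Fintype.card F : ℤ) - 1) ^ r := by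
  classical
  have h1 : Nat.card (DSGMeet F r) +
      Nat.card {p : (Fin r → F) × (Fin r → F) // ¬ ∃ i, p.1 i ≠ 0 ∧ p.2 i ≠ 0}
      = Nat.card ((Fin r → F) × (Fin r → F)) := by
    rw [← Nat.card_sum]
    exact Nat.card_congr (Equiv.sumCompl _)
  have e : {p : (Fin r → F) × (Fin r → F) // ¬ ∃ i, p.1 i ≠ 0 ∧ p.2 i ≠ 0} ≃
      (Fin r → {c : F × F // c.1 = 0 ∨ c.2 = 0}) :=
    { toFun := fun p i => ⟨(p.1.1 i, p.1.2 i), by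
        by_contra h
        exact p.2 ⟨i, not_or.1 h⟩⟩
      invFun := fun f => ⟨(fun i => (f i).1.1, fun i => (f i).1.2), by
        rintro ⟨i, h, h'⟩
        exact (f i).2.elim h h'⟩
      left_inv := fun _ => rfl
      right_inv := fun _ => rfl }
  rw [Nat.card_congr e, Nat.card_prod, Nat.card_fun, Nat.card_fun, Nat.card_fin] at h1
  zify at h1
  rw [dsg_pair_card, Nat.card_eq_fintype_card (α := F)] at h1
  rw [two_mul r, pow_add]
  linarith

lemma dsg_ne_card (F : Type*) [Field F] [Fintype F] [DecidableEq F] (r : ℕ) :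
    (Nat.card {a : Fin r → F // a ≠ 0} : ℤ) = (Fintype.card F : ℤ) ^ r - 1 := by
  have h2 : 1 + Nat.card {a : Fin r → F // ¬ a = 0} = Nat.card (Fin r → F) := by
    rw [← Nat.card_congr (Equiv.sumCompl (fun a : Fin r → F => a = 0)), Nat.card_sum]
    simp
  rw [Nat.card_fun, Nat.card_fin, Nat.card_eq_fintype_card (α := F)] at h2
  zify at h2
  simp only [ne_eq]
  linarith

/-- Ordered pairs (including equal ones) decompose into darts and vertices. -/
noncomputable def dsgEquiv (F : Type*) [Field F] (r s : ℕ) :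
    {z : DSGMeet F r × DSGMeet F s // ¬ (z.1.1.1 = z.1.1.2 ∧ z.2.1.1 = z.2.1.2)} ≃
      (directSumGraph F r s).Dart where
  toFun z := ⟨(⟨(z.1.1.1.1, z.1.2.1.1), by
      obtain ⟨i, hi, -⟩ := z.1.1.2
      obtain ⟨j, hj, -⟩ := z.1.2.2
      exact ⟨fun h => hi (congrFun h i), fun h => hj (congrFun h j)⟩⟩,
      ⟨(z.1.1.1.2, z.1.2.1.2), by
      obtain ⟨i, -, hi⟩ := z.1.1.2
      obtain ⟨j, -, hj⟩ := z.1.2.2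
      exact ⟨fun h => hi (congrFun h i), fun h => hj (congrFun h j)⟩⟩),
      ⟨fun h => z.2 (Prod.ext_iff.1 (Subtype.ext_iff.1 h)), z.1.1.2, z.1.2.2⟩⟩
  invFun d := ⟨(⟨(d.fst.1.1, d.snd.1.1), d.adj.2.1⟩, ⟨(d.fst.1.2, d.snd.1.2), d.adj.2.2⟩),
    fun h => d.adj.1 (Subtype.ext (Prod.ext h.1 h.2))⟩
  left_inv _ := rfl
  right_inv _ := rfl

noncomputable def dsgDiag (F : Type*) [Field F] (r s : ℕ) :
    {z : DSGMeet F r × DSGMeet F s // z.1.1.1 = z.1.1.2 ∧ z.2.1.1 = z.2.1.2} ≃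
      {a : Fin r → F // a ≠ 0} × {b : Fin s → F // b ≠ 0} where
  toFun z := (⟨z.1.1.1.1, by
      obtain ⟨i, hi, -⟩ := z.1.1.2
      exact fun h => hi (congrFun h i)⟩, ⟨z.1.2.1.1, by
      obtain ⟨i, hi, -⟩ := z.1.2.2
      exact fun h => hi (congrFun h i)⟩)
  invFun p := ⟨(⟨(p.1.1, p.1.1), by
      obtain ⟨i, hi⟩ := Function.ne_iff.1 p.1.2
      exact ⟨i, hi, hi⟩⟩, ⟨(p.2.1, p.2.1), by
      obtain ⟨i, hi⟩ := Function.ne_iff.1 p.2.2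
      exact ⟨i, hi, hi⟩⟩), rfl, rfl⟩
  left_inv := by
    rintro ⟨⟨⟨⟨a, b⟩, h⟩, ⟨⟨c, d⟩, h'⟩⟩, h1, h2⟩
    dsimp at h1 h2
    subst h1 h2
    rfl
  right_inv _ := rfl

/-- Twice the number `M` of edges of the direct sum graph equals
`(q^{2r} − (2q − 1)^r)(q^{2s} − (2q − 1)^s) − (q^r − 1)(q^s − 1)`. -/
theorem directSumGraph_size (F : Type*) [Field F] [Fintype F] [DecidableEq F]
    (q r s : ℕ) (hr : 1 ≤ r) (hs : 1 ≤ s) (hq : Fintype.card F = q) :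
    (2 * (directSumGraph F r s).edgeFinset.card : ℤ) =
      ((q : ℤ) ^ (2 * r) - (2 * (q : ℤ) - 1) ^ r) *
        ((q : ℤ) ^ (2 * s) - (2 * (q : ℤ) - 1) ^ s) -
      ((q : ℤ) ^ r - 1) * ((q : ℤ) ^ s - 1) := by
  classical
  subst hq
  have h1 := Nat.card_congr (Equiv.sumCompl
    (fun z : DSGMeet F r × DSGMeet F s => z.1.1.1 = z.1.1.2 ∧ z.2.1.1 = z.2.1.2))
  rw [Nat.card_sum, Nat.card_congr (dsgEquiv F r s), Nat.card_congr (dsgDiag F r s),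
    Nat.card_prod, Nat.card_prod, Nat.card_eq_fintype_card (α := SimpleGraph.Dart _),
    SimpleGraph.dart_card_eq_twice_card_edges] at h1
  zify at h1
  rw [dsg_meet_card, dsg_meet_card, dsg_ne_card, dsg_ne_card] at h1
  rw [← h1]
  have : ∀ (a b c : ℤ), a = b → a = c + b - c := by intros; linarith
  apply this
  congr!
end

section
/- If n = dim V ≥ 4, then the girth of Γ_{U⊕W}(V) (the length of its shortest cycle) equals 3. -/
theorem dsg_aux (F : Type*) [Field F] (r s : ℕ) (i : Fin r) (j : Fin s)
    (x y z : (Fin r → F) × (Fin s → F))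
    (hx : x.1 i ≠ 0 ∧ x.2 j ≠ 0) (hy : y.1 i ≠ 0 ∧ y.2 j ≠ 0) (hz : z.1 i ≠ 0 ∧ z.2 j ≠ 0)
    (hxy : x ≠ y) (hyz : y ≠ z) (hzx : z ≠ x) :
    (directSumGraph F r s).girth = 3 := by
  have key : ∀ v : (Fin r → F) × (Fin s → F), (v.1 i ≠ 0 ∧ v.2 j ≠ 0) → v.1 ≠ 0 ∧ v.2 ≠ 0 := by
    intro v hv
    exact ⟨fun h => hv.1 (by rw [h]; rfl), fun h => hv.2 (by rw [h]; rfl)⟩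
  let X : {x : (Fin r → F) × (Fin s → F) // x.1 ≠ 0 ∧ x.2 ≠ 0} := ⟨x, key x hx⟩
  let Y : {x : (Fin r → F) × (Fin s → F) // x.1 ≠ 0 ∧ x.2 ≠ 0} := ⟨y, key y hy⟩
  let Z : {x : (Fin r → F) × (Fin s → F) // x.1 ≠ 0 ∧ x.2 ≠ 0} := ⟨z, key z hz⟩
  have nXY : X ≠ Y := fun h => hxy (congrArg Subtype.val h)
  have nYZ : Y ≠ Z := fun h => hyz (congrArg Subtype.val h)
  have nZX : Z ≠ X := fun h => hzx (congrArg Subtype.val h)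
  have aXY : (directSumGraph F r s).Adj X Y := ⟨nXY, ⟨i, hx.1, hy.1⟩, ⟨j, hx.2, hy.2⟩⟩
  have aYZ : (directSumGraph F r s).Adj Y Z := ⟨nYZ, ⟨i, hy.1, hz.1⟩, ⟨j, hy.2, hz.2⟩⟩
  have aZX : (directSumGraph F r s).Adj Z X := ⟨nZX, ⟨i, hz.1, hx.1⟩, ⟨j, hz.2, hx.2⟩⟩
  clear_value X Y Z
  have hc : (SimpleGraph.Walk.cons aXY (.cons aYZ (.cons aZX .nil))).IsCycle := by
    simp [SimpleGraph.Walk.isCycle_def, SimpleGraph.Walk.isTrail_def, nXY, nYZ, nZX, nXY.symm,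
      nYZ.symm, nZX.symm]
  refine le_antisymm ?_ (SimpleGraph.three_le_girth fun h => h _ hc)
  simpa using SimpleGraph.girth_le_length hc

/-- If `n = dim V ≥ 4`, the girth of the direct sum graph is 3. -/
theorem directSumGraph_girth (F : Type*) [Field F] [Fintype F]
    (r s : ℕ) (hr : 1 ≤ r) (hs : 1 ≤ s) (hn : 4 ≤ r + s) :
    (directSumGraph F r s).girth = 3 := by
  obtain h | h | ⟨h1, h2⟩ : 3 ≤ r ∨ 3 ≤ s ∨ (2 ≤ r ∧ 2 ≤ s) := by omega
  · refine dsg_aux F r s ⟨0, by omega⟩ ⟨0, by omega⟩ (1, 1)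
      (fun i => if i.val = 1 then 0 else 1, 1) (fun i => if i.val = 2 then 0 else 1, 1)
      (by simp) (by simp) (by simp) ?_ ?_ ?_ <;> intro h
    · simpa using congrFun (congrArg Prod.fst h) ⟨1, by omega⟩
    · simpa using congrFun (congrArg Prod.fst h) ⟨1, by omega⟩
    · simpa using congrFun (congrArg Prod.fst h) ⟨2, by omega⟩
  · refine dsg_aux F r s ⟨0, by omega⟩ ⟨0, by omega⟩ (1, 1)
      (1, fun i => if i.val = 1 then 0 else 1) (1, fun i => if i.val = 2 then 0 else 1)
      (by simp) (by simp) (by simp) ?_ ?_ ?_ <;> intro h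
    · simpa using congrFun (congrArg Prod.snd h) ⟨1, by omega⟩
    · simpa using congrFun (congrArg Prod.snd h) ⟨1, by omega⟩
    · simpa using congrFun (congrArg Prod.snd h) ⟨2, by omega⟩
  · refine dsg_aux F r s ⟨0, by omega⟩ ⟨0, by omega⟩ (1, 1)
      (fun i => if i.val = 1 then 0 else 1, 1) (1, fun i => if i.val = 1 then 0 else 1)
      (by simp) (by simp) (by simp) ?_ ?_ ?_ <;> intro h
    · simpa using congrFun (congrArg Prod.fst h) ⟨1, by omega⟩
    · simpa using congrFun (congrArg Prod.fst h) ⟨1, by omega⟩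
    · simpa using congrFun (congrArg Prod.snd h) ⟨1, by omega⟩
end

section
/- Fix an integer k₁ with 1 ≤ k₁ ≤ r/2, set k₂ = ⌊s/2⌋ + 1, and fix an index i ∈ {1,…,r}. Then the set M = {x vertex of Γ_{U⊕W}(V) : i ∈ S_x^U, |S_x^U| ≥ k₁ and |S_x^W| ≥ k₂} is a clique of Γ_{U⊕W}(V), and |M| = (q−1) · Σ_{a=k₁−1}^{r−1} Σ_{b=k₂}^{s} C(r−1, a) C(s, b) (q−1)^{a+b}. -/
open Finset in
theorem dsg_suppCard (F : Type*) [Field F] [Fintype F] [DecidableEq F] (n : ℕ) (T : Finset (Fin n)) :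
    (univ.filter fun f : Fin n → F => (univ.filter fun a => f a ≠ 0) = T).card
      = (Fintype.card F - 1) ^ T.card := by
  have h : (univ.filter fun f : Fin n → F => (univ.filter fun a => f a ≠ 0) = T)
      = Fintype.piFinset (fun j => if j ∈ T then univ.erase (0:F) else {0}) := by
    ext f
    simp only [mem_filter, mem_univ, true_and, Fintype.mem_piFinset, Finset.ext_iff]
    refine forall_congr' fun j => ?_
    by_cases hj : j ∈ T <;> simp [hj]
  rw [h, Fintype.card_piFinset]
  have h2 : ∀ j : Fin n, (if j ∈ T then univ.erase (0:F) else {0}).card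
      = if j ∈ T then Fintype.card F - 1 else 1 := by
    intro j
    split_ifs
    · rw [card_erase_of_mem (mem_univ _), card_univ]
    · simp
  simp only [h2]
  rw [prod_ite_mem]
  simp

open Finset in
theorem dsg_geCard (F : Type*) [Field F] [Fintype F] [DecidableEq F] (n k : ℕ) :
    (univ.filter fun f : Fin n → F => k ≤ (univ.filter fun a => f a ≠ 0).card).card
      = ∑ a ∈ Icc k n, n.choose a * (Fintype.card F - 1) ^ a := by
  rw [card_eq_sum_card_fiberwise (f := fun f : Fin n → F => (univ.filter fun a => f a ≠ 0).card)
    (t := Icc k n)]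
  · refine sum_congr rfl fun a ha => ?_
    rw [card_eq_sum_card_fiberwise (f := fun f : Fin n → F => (univ.filter fun a => f a ≠ 0))
      (t := powersetCard a univ)]
    · rw [sum_congr rfl (g := fun _ => (Fintype.card F - 1) ^ a)]
      · simp
      · intro T hT
        rw [mem_powersetCard] at hT
        rw [← hT.2, ← dsg_suppCard F n T]
        congr 1
        ext f
        simp only [mem_filter, mem_univ, true_and]
        rw [mem_Icc] at ha
        constructor
        · exact fun h => h.2
        · intro h
          rw [h]
          exact ⟨⟨by omega, rfl⟩, rfl⟩
    · intro f hf
      simp at hf ⊢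
      exact hf.2
  · intro f hf
    simp only [coe_filter, mem_univ, true_and, Set.mem_ofPred_eq] at hf
    simp only [coe_Icc, Set.mem_Icc]
    exact ⟨hf, (card_le_univ _).trans (by simp)⟩

open Finset in
theorem dsg_geCard' (F : Type*) [Field F] [Fintype F] [DecidableEq F] (m k : ℕ) (hk : 1 ≤ k)
    (i : Fin (m+1)) :
    (univ.filter fun f : Fin (m+1) → F => f i ≠ 0 ∧
      k ≤ (univ.filter fun a => f a ≠ 0).card).card
      = (Fintype.card F - 1) * ∑ a ∈ Icc (k-1) m, m.choose a * (Fintype.card F - 1) ^ a := by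
  rw [← dsg_geCard]
  have h1 : (univ.erase (0:F)).card = Fintype.card F - 1 := by
    rw [card_erase_of_mem (mem_univ _), card_univ]
  rw [← h1, ← card_product]
  refine card_equiv (Fin.insertNthEquiv (fun _ => F) i).symm fun f => ?_
  have h2 : (univ.filter fun a => f a ≠ 0).card
      = (if f i ≠ 0 then 1 else 0) + (univ.filter fun a => f (i.succAbove a) ≠ 0).card := by
    rw [card_filter, Fin.sum_univ_succAbove _ i, card_filter]
  simp only [mem_filter, mem_univ, true_and, mem_product, mem_erase, and_true,
    Fin.insertNthEquiv_symm_apply, Fin.removeNth]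
  refine and_congr_right fun h => ?_
  rw [if_pos h] at h2
  rw [h2]
  change _ ↔ k - 1 ≤ (univ.filter fun a => f (i.succAbove a) ≠ 0).card
  generalize (univ.filter fun a => f (i.succAbove a) ≠ 0).card = c
  omega

/-- For `1 ≤ k₁ ≤ r/2`, `k₂ = ⌊s/2⌋ + 1` and a fixed index `i`, the set of vertices
containing `α_i` in their skeleton and whose `U`- and `W`-skeletons have at least `k₁`
resp. `k₂` elements is a clique, of the stated cardinality. -/
theorem directSumGraph_clique_card_two (F : Type*) [Field F] [Fintype F] [DecidableEq F]
    (q r s k₁ : ℕ) (hq : Fintype.card F = q)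
    (hk₁ : 1 ≤ k₁) (hk₁r : 2 * k₁ ≤ r) (i : Fin r) :
    (directSumGraph F r s).IsClique
      {x | x.val.1 i ≠ 0 ∧
        k₁ ≤ (Finset.univ.filter fun a => x.val.1 a ≠ 0).card ∧
        s / 2 + 1 ≤ (Finset.univ.filter fun b => x.val.2 b ≠ 0).card} ∧
    ({x | x.val.1 i ≠ 0 ∧
        k₁ ≤ (Finset.univ.filter fun a => x.val.1 a ≠ 0).card ∧
        s / 2 + 1 ≤ (Finset.univ.filter fun b => x.val.2 b ≠ 0).card} :
          Set {x : (Fin r → F) × (Fin s → F) // x.1 ≠ 0 ∧ x.2 ≠ 0}).ncard =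
      (q - 1) * ∑ a ∈ Finset.Icc (k₁ - 1) (r - 1), ∑ b ∈ Finset.Icc (s / 2 + 1) s,
        (r - 1).choose a * s.choose b * (q - 1) ^ (a + b) := by
  have hr : r = (r - 1) + 1 := by omega
  refine ⟨?_, ?_⟩
  · rintro x ⟨hx1, -, hx2⟩ y ⟨hy1, -, hy2⟩ hxy
    refine ⟨hxy, ⟨i, hx1, hy1⟩, ?_⟩
    by_contra hcon
    have hd : Disjoint (Finset.univ.filter fun b => x.val.2 b ≠ 0)
        (Finset.univ.filter fun b => y.val.2 b ≠ 0) := by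
      rw [Finset.disjoint_left]
      intro j hj hj'
      simp only [Finset.mem_filter, Finset.mem_univ, true_and] at hj hj'
      exact hcon ⟨j, hj, hj'⟩
    have h1 := Finset.card_union_of_disjoint hd
    have h2 := Finset.card_le_univ ((Finset.univ.filter fun b => x.val.2 b ≠ 0) ∪
        (Finset.univ.filter fun b => y.val.2 b ≠ 0))
    rw [Fintype.card_fin] at h2
    omega
  · obtain ⟨m, rfl⟩ : ∃ m, r = m + 1 := ⟨r - 1, hr⟩
    subst hq
    rw [← Set.ncard_image_of_injective _ Subtype.val_injective]
    have key : (Subtype.val '' ({x | x.val.1 i ≠ 0 ∧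
        k₁ ≤ (Finset.univ.filter fun a => x.val.1 a ≠ 0).card ∧
        s / 2 + 1 ≤ (Finset.univ.filter fun b => x.val.2 b ≠ 0).card} :
          Set {x : (Fin (m + 1) → F) × (Fin s → F) // x.1 ≠ 0 ∧ x.2 ≠ 0}))
        = (((Finset.univ.filter fun f : Fin (m+1) → F => f i ≠ 0 ∧
            k₁ ≤ (Finset.univ.filter fun a => f a ≠ 0).card) ×ˢ
          (Finset.univ.filter fun f : Fin s → F =>
            s / 2 + 1 ≤ (Finset.univ.filter fun a => f a ≠ 0).card) : Finset _) :
            Set ((Fin (m + 1) → F) × (Fin s → F))) := by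
      ext ⟨f, g⟩
      simp only [Set.mem_image, Set.mem_ofPred_eq, Finset.mem_coe, Finset.mem_product,
        Finset.mem_filter, Finset.mem_univ, true_and]
      constructor
      · rintro ⟨x, ⟨h1, h2, h3⟩, hx⟩
        rw [hx] at h1 h2 h3
        exact ⟨⟨h1, h2⟩, h3⟩
      · rintro ⟨⟨h1, h2⟩, h3⟩
        refine ⟨⟨(f, g), ?_, ?_⟩, ⟨h1, h2, h3⟩, rfl⟩
        · rintro h
          exact h1 (congrFun h i)
        · intro h
          have h' : g = 0 := h
          simp [h'] at h3
    rw [key, Set.ncard_coe_finset, Finset.card_product, dsg_geCard' F m k₁ hk₁ i, dsg_geCard,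
      mul_assoc, Finset.sum_mul_sum]
    simp only [Nat.add_sub_cancel]
    congr 1
    refine Finset.sum_congr rfl fun a _ => Finset.sum_congr rfl fun b _ => ?_
    ring
end

section
/- If q = 2 and n = dim V ≥ 4, then the clique number of Γ_{U⊕W}(V) equals 2^{n−2}. -/
lemma dsg_field_two {F : Type*} [Field F] [Fintype F] (hq : Fintype.card F = 2)
    {a b : F} (ha : a ≠ 0) (hb : b ≠ 0) : a = b := by
  classical
  by_contra h
  have h3 : ({0, a, b} : Finset F).card = 3 := by
    rw [Finset.card_eq_three]
    exact ⟨0, a, b, ha.symm, hb.symm, h, rfl⟩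
  have := Finset.card_le_univ ({0, a, b} : Finset F)
  omega

open Classical in
/-- the support of a coefficient tuple -/
noncomputable def dsgSupp {F : Type*} [Field F] {r : ℕ} (x : Fin r → F) : Finset (Fin r) :=
  Finset.univ.filter (fun i => x i ≠ 0)

lemma dsgSupp_inj {F : Type*} [Field F] [Fintype F] (hq : Fintype.card F = 2) {r : ℕ} :
    Function.Injective (dsgSupp : (Fin r → F) → Finset (Fin r)) := by
  intro x y h
  funext i
  have hi : x i ≠ 0 ↔ y i ≠ 0 := by
    have := Finset.ext_iff.1 h i
    simpa [dsgSupp] using this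
  by_cases hx : x i = 0
  · have : y i = 0 := by
      by_contra hy
      exact hi.2 hy hx
    rw [hx, this]
  · exact dsg_field_two hq hx (hi.1 hx)

lemma dsg_card_le {F : Type*} [Field F] [Fintype F] (hq : Fintype.card F = 2) {a : ℕ}
    (P : Finset (Fin (a + 1) → F)) (hP : ∀ x ∈ P, ∀ y ∈ P, ∃ i, x i ≠ 0 ∧ y i ≠ 0) :
    P.card ≤ 2 ^ a := by
  classical
  have h : ((P.image dsgSupp : Finset (Finset (Fin (a + 1)))) :
      Set (Finset (Fin (a + 1)))).Intersecting := by
    intro A hA B hB hAB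
    simp only [Finset.coe_image, Set.mem_image, Finset.mem_coe] at hA hB
    obtain ⟨x, hx, rfl⟩ := hA
    obtain ⟨y, hy, rfl⟩ := hB
    obtain ⟨i, h1, h2⟩ := hP x hx y hy
    exact (Finset.disjoint_left.1 hAB : ∀ ⦃k⦄, _ → _) (show i ∈ _ by simpa [dsgSupp] using h1)
      (by simpa [dsgSupp] using h2)
  have h2 := h.card_le
  rw [Finset.card_image_of_injective _ (dsgSupp_inj hq), Fintype.card_finset,
    Fintype.card_fin, pow_succ] at h2
  omega

/-- If `q = 2` and `n = dim V ≥ 4`, the clique number of the direct sum graph is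
`2^{n−2}`. -/
theorem directSumGraph_cliqueNum (F : Type*) [Field F] [Fintype F]
    (hq : Fintype.card F = 2) (r s : ℕ) (hr : 1 ≤ r) (hs : 1 ≤ s) (hn : 4 ≤ r + s) :
    (directSumGraph F r s).cliqueNum = 2 ^ (r + s - 2) := by
  classical
  obtain ⟨a, rfl⟩ : ∃ a, r = a + 1 := ⟨r - 1, by omega⟩
  obtain ⟨b, rfl⟩ : ∃ b, s = b + 1 := ⟨s - 1, by omega⟩
  have he : a + 1 + (b + 1) - 2 = a + b := by omega
  rw [he, pow_add]
  apply le_antisymm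
  · obtain ⟨t, ht⟩ := (directSumGraph F (a + 1) (b + 1)).exists_isNClique_cliqueNum
    rw [← ht.card_eq]
    have hc : ∀ x ∈ t, ∀ y ∈ t, (∃ i, x.val.1 i ≠ 0 ∧ y.val.1 i ≠ 0) ∧
        (∃ j, x.val.2 j ≠ 0 ∧ y.val.2 j ≠ 0) := by
      intro x hx y hy
      by_cases hxy : x = y
      · subst hxy
        obtain ⟨i, hi⟩ := Function.ne_iff.1 x.2.1
        obtain ⟨j, hj⟩ := Function.ne_iff.1 x.2.2
        exact ⟨⟨i, hi, hi⟩, ⟨j, hj, hj⟩⟩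
      · exact (ht.isClique hx hy hxy).2
    have h1 : (t.image (fun x => x.val.1)).card ≤ 2 ^ a := by
      apply dsg_card_le hq
      intro u hu v hv
      obtain ⟨x, hx, rfl⟩ := Finset.mem_image.1 hu
      obtain ⟨y, hy, rfl⟩ := Finset.mem_image.1 hv
      exact (hc x hx y hy).1
    have h2 : (t.image (fun x => x.val.2)).card ≤ 2 ^ b := by
      apply dsg_card_le hq
      intro u hu v hv
      obtain ⟨x, hx, rfl⟩ := Finset.mem_image.1 hu
      obtain ⟨y, hy, rfl⟩ := Finset.mem_image.1 hv
      exact (hc x hx y hy).2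
    calc t.card = (t.image Subtype.val).card :=
          (Finset.card_image_of_injective _ Subtype.val_injective).symm
      _ ≤ ((t.image (fun x => x.val.1)) ×ˢ (t.image (fun x => x.val.2))).card := by
          apply Finset.card_le_card
          intro z hz
          obtain ⟨x, hx, rfl⟩ := Finset.mem_image.1 hz
          exact Finset.mem_product.2 ⟨Finset.mem_image.2 ⟨x, hx, rfl⟩,
            Finset.mem_image.2 ⟨x, hx, rfl⟩⟩
      _ ≤ 2 ^ a * 2 ^ b := by
          rw [Finset.card_product]
          exact Nat.mul_le_mul h1 h2
  · let f : (Fin a → F) × (Fin b → F) →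
        {x : (Fin (a + 1) → F) × (Fin (b + 1) → F) // x.1 ≠ 0 ∧ x.2 ≠ 0} := fun p =>
      ⟨(Fin.cons 1 p.1, Fin.cons 1 p.2),
        fun h => by simpa using congrFun h 0, fun h => by simpa using congrFun h 0⟩
    have hf : Function.Injective f := by
      intro p q h
      have h' := congrArg Subtype.val h
      have e1 := congrArg Prod.fst h'
      have e2 := congrArg Prod.snd h'
      exact Prod.ext (Fin.cons_right_injective (α := fun _ => F) 1 e1)
        (Fin.cons_right_injective (α := fun _ => F) 1 e2)
    have hcl : (directSumGraph F (a + 1) (b + 1)).IsClique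
        ((Finset.univ.image f : Finset _) : Set _) := by
      intro x hx y hy hxy
      obtain ⟨p, -, rfl⟩ := Finset.mem_image.1 (Finset.mem_coe.1 hx)
      obtain ⟨q, -, rfl⟩ := Finset.mem_image.1 (Finset.mem_coe.1 hy)
      exact ⟨hxy, ⟨0, by simp [f], by simp [f]⟩, ⟨0, by simp [f], by simp [f]⟩⟩
    have h := hcl.card_le_cliqueNum
    rw [Finset.card_image_of_injective _ hf] at h
    simpa [hq] using h
end

section
/- If q = 2 and n = dim V ≥ 4, then the chromatic number χ of Γ_{U⊕W}(V) satisfies 2^{n−2} ≤ χ ≤ (2^n − (2^r + 2^s + r·s))/2 + 2^{n−3} + 1. -/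
theorem dsg_nz {F : Type*} [Field F] [Fintype F] (hq : Fintype.card F = 2) (x y : F)
    (hx : x ≠ 0) (hy : y ≠ 0) : x = y := by
  classical
  by_contra h
  have h3 : ({0, x, y} : Finset F).card = 3 := by
    rw [Finset.card_eq_three]
    exact ⟨0, x, y, hx.symm, hy.symm, h, rfl⟩
  have := Finset.card_le_univ ({0, x, y} : Finset F)
  omega

/-- differences with the zeroth coordinate -/
def dsgD {F : Type*} [Field F] {m : ℕ} (a : Fin (m + 1) → F) : Fin m → F :=
  fun i => a i.succ - a 0

theorem dsgD_inj {F : Type*} [Field F] [Fintype F] (hq : Fintype.card F = 2) {m : ℕ}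
    (a b : Fin (m + 1) → F) (h : dsgD a = dsgD b) (i : Fin (m + 1)) (ha : a i ≠ 0)
    (hb : b i ≠ 0) : a = b := by
  have hi := dsg_nz hq _ _ ha hb
  have hd : ∀ j : Fin (m + 1), a j - a 0 = b j - b 0 := by
    intro j
    refine Fin.cases ?_ (fun k => ?_) j
    · simp
    · exact congrFun h k
  have h0 : a 0 = b 0 := by
    have := hd i
    rw [hi] at this
    exact sub_right_injective this
  funext j
  have := hd j
  rw [h0] at this
  exact sub_left_injective this

theorem dsgD_zero {F : Type*} [Field F] {m : ℕ}
    (a : Fin (m + 1) → F) (h : dsgD a = 0) (ha : a ≠ 0) : a 0 ≠ 0 := by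
  intro h0
  apply ha
  funext j
  refine Fin.cases h0 (fun k => ?_) j
  have := congrFun h k
  simpa [dsgD, h0] using this

theorem dsg_arith (r s : ℕ) : (r + 1) * (s + 1) ≤ 2 ^ (r + s) := by
  have h1 : r + 1 ≤ 2 ^ r := Nat.lt_two_pow_self
  have h2 : s + 1 ≤ 2 ^ s := Nat.lt_two_pow_self
  rw [pow_add]
  exact Nat.mul_le_mul h1 h2

theorem directSumGraph_chromaticNumber (F : Type*) [Field F] [Fintype F]
    (hq : Fintype.card F = 2) (r s : ℕ) (hr : 1 ≤ r) (hs : 1 ≤ s) (hn : 4 ≤ r + s) :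
    ((2 ^ (r + s - 2) : ℕ) : ℕ∞) ≤ (directSumGraph F r s).chromaticNumber ∧
    (directSumGraph F r s).chromaticNumber ≤
      (((2 ^ (r + s) - (2 ^ r + 2 ^ s + r * s)) / 2 + 2 ^ (r + s - 3) + 1 : ℕ) : ℕ∞) := by
  classical
  obtain ⟨r, rfl⟩ : ∃ k, r = k + 1 := ⟨r - 1, by omega⟩
  obtain ⟨s, rfl⟩ : ∃ k, s = k + 1 := ⟨s - 1, by omega⟩
  constructor
  · let f : (⊤ : SimpleGraph ((Fin r → F) × (Fin s → F))) →g
        directSumGraph F (r + 1) (s + 1) :=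
      { toFun := fun p => ⟨(Fin.cons 1 p.1, Fin.cons 1 p.2),
          fun h => by simpa using congrFun h 0, fun h => by simpa using congrFun h 0⟩
        map_rel' := by
          intro p q hpq
          refine ⟨fun h => hpq ?_, ⟨0, by simp, by simp⟩, ⟨0, by simp, by simp⟩⟩
          have h' := congrArg Subtype.val h
          simp only [Prod.mk.injEq] at h'
          exact Prod.ext (Fin.cons_right_injective _ h'.1) (Fin.cons_right_injective _ h'.2) }
    have := SimpleGraph.chromaticNumber_mono_of_hom f
    rw [SimpleGraph.chromaticNumber_top] at this
    refine le_trans (le_of_eq ?_) this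
    simp only [Fintype.card_prod, Fintype.card_fun, Fintype.card_fin, hq]
    rw [← pow_add]
    congr 2
    omega
  · let C : (directSumGraph F (r + 1) (s + 1)).Coloring
        (({u : Fin r → F // u ≠ 0} × {b : Fin (s + 1) → F // b ≠ 0}) ⊕ (Fin s → F)) :=
      SimpleGraph.Coloring.mk
        (fun x => if h : dsgD x.1.1 ≠ 0 then Sum.inl (⟨dsgD x.1.1, h⟩, ⟨x.1.2, x.2.2⟩)
          else Sum.inr (dsgD x.1.2)) (by
        rintro ⟨⟨a, b⟩, ha, hb⟩ ⟨⟨a', b'⟩, ha', hb'⟩ ⟨hne, ⟨i, hi, hi'⟩, ⟨j, hj, hj'⟩⟩ heq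
        apply hne
        simp only at hi hi' hj hj' ha ha' hb hb'
        by_cases h : dsgD a = 0 <;> by_cases h' : dsgD a' = 0 <;> simp [h, h'] at heq
        · have e1 := dsgD_inj hq a a' (h.trans h'.symm) i hi hi'
          have e2 := dsgD_inj hq b b' heq j hj hj'
          subst e1 e2; rfl
        · have e1 := dsgD_inj hq a a' heq.1 i hi hi'
          have e2 := heq.2
          subst e1 e2; rfl)
    have hc := C.colorable.chromaticNumber_le
    refine le_trans hc (Nat.cast_le.mpr ?_)
    have hcard : ∀ m : ℕ, Fintype.card {u : Fin m → F // u ≠ 0} = 2 ^ m - 1 := by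
      intro m
      rw [Fintype.card_subtype_compl, Fintype.card_subtype_eq]
      simp [hq]
    rw [Fintype.card_sum, Fintype.card_prod, hcard, hcard]
    simp only [Fintype.card_fun, Fintype.card_fin, hq]
    have ha := dsg_arith r s
    obtain ⟨k, hk⟩ : ∃ k, r + s = k + 1 := ⟨r + s - 1, by omega⟩
    have e3 : r + 1 + (s + 1) - 3 = k := by omega
    have e4 : r + 1 + (s + 1) = r + s + 2 := by omega
    have hP : 2 ^ (r + s) = 2 * 2 ^ k := by rw [hk, pow_succ]; ring
    have hQ : 2 ^ (r + s) = 2 ^ r * 2 ^ s := pow_add _ _ _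
    rw [e3, e4, pow_add 2 (r + s) 2]
    simp only [pow_succ 2 r, pow_succ 2 s]
    have h1 : 1 ≤ 2 ^ r := Nat.one_le_two_pow
    have h2 : 1 ≤ 2 ^ s := Nat.one_le_two_pow
    generalize 2 ^ r = A at *
    generalize 2 ^ s = B at *
    generalize 2 ^ (r + s) = P at *
    generalize 2 ^ k = K at *
    generalize (r + 1) * (s + 1) = M at *
    obtain ⟨A, rfl⟩ : ∃ x, A = x + 1 := ⟨A - 1, by omega⟩
    obtain ⟨B, rfl⟩ : ∃ x, B = x + 1 := ⟨B - 1, by omega⟩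
    have e5 : (A + 1 - 1) * ((B + 1) * 2 - 1) = 2 * (A * B) + A := by
      have : (B + 1) * 2 - 1 = 2 * B + 1 := by omega
      rw [this, Nat.add_sub_cancel]; ring
    rw [e5]
    have e6 : (A + 1) * (B + 1) = A * B + A + B + 1 := by ring
    rw [e6] at hQ
    generalize A * B = X at *
    omega
end
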